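/- Let N ≥ 10^{100000} be a real number and let 2 ≤ k ≤ 6 be an integer. Then for every real x ≥ 10^5, writing g_{k,N}(x) = (−1)^k · f_N^{(k)}(x), one has (k−1)!·log N/(x^k·(log x)²) < g_{k,N}(x) < τ_k·log N/(x^k·(log x)²), where τ_2 = 1.17372, τ_3 = 2.56643, τ_4 = 8.19823, τ_5 = 34.4344, τ_6 = 179.227. -/

import Mathlib

theorem iteratedDeriv_eqOn_of_hasDerivAt {F : ℕ → ℝ → ℝ} {s : Set ℝ} (hs : IsOpen s)
    (h : ∀ n, ∀ y ∈ s, HasDerivAt (F n) (F (n + 1) y) y) (n : ℕ) :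
    Set.EqOn (iteratedDeriv n (F 0)) (F n) s := by
  induction n with
  | zero => intro y _; simp
  | succ n ih =>
    intro y hy
    rw [iteratedDeriv_succ, (ih.eventuallyEq_of_mem (hs.mem_nhds hy)).deriv_eq]
    exact (h n y hy).deriv

/-- The polynomials `P k` with `(-1) ^ k * (1 / log)^(k) x = P k (1 / log x) / x ^ k`. -/
noncomputable def invLogPoly : ℕ → Polynomial ℝ
  | 0 => Polynomial.X
  | k + 1 => (k : Polynomial ℝ) * invLogPoly k +
      Polynomial.X ^ 2 * Polynomial.derivative (invLogPoly k)

theorem iteratedDeriv_inv_log (n : ℕ) {x : ℝ} (hx : 1 < x) :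
    iteratedDeriv n (fun y => (Real.log y)⁻¹) x
      = (-1) ^ n * (invLogPoly n).eval (Real.log x)⁻¹ / x ^ n := by
  let F : ℕ → ℝ → ℝ := fun n y => (-1) ^ n * (invLogPoly n).eval (Real.log y)⁻¹ / y ^ n
  have hF : F 0 = fun y => (Real.log y)⁻¹ := by ext y; simp [F, invLogPoly]
  rw [← hF]
  refine iteratedDeriv_eqOn_of_hasDerivAt isOpen_Ioi (fun n y hy => ?_) n hx
  have hy : 1 < y := hy
  have hy0 : y ≠ 0 := by positivity
  have hl : Real.log y ≠ 0 := (Real.log_pos hy).ne'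
  have h1 := (Real.hasDerivAt_log hy0).fun_inv hl
  have h2 := ((((invLogPoly n).hasDerivAt (Real.log y)⁻¹).comp y h1).const_mul
    ((-1 : ℝ) ^ n)).fun_div (hasDerivAt_pow n y) (pow_ne_zero n hy0)
  refine h2.congr_deriv ?_
  simp only [F, invLogPoly, Polynomial.eval_add, Polynomial.eval_mul, Polynomial.eval_natCast,
    Polynomial.eval_pow, Polynomial.eval_X, Function.comp]
  rcases n with _ | n
  · simp; field_simp
  · simp only [Nat.add_sub_cancel]
    field_simp
    ring

theorem iteratedDeriv_log_sub_one_sub_log (c : ℝ) (n : ℕ) {x : ℝ} (hx : 1 < x) :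
    iteratedDeriv (n + 1) (fun y => c + (Real.log (y - 1) - Real.log y)) x
      = (-1) ^ n * n.factorial * (((x - 1) ^ (n + 1))⁻¹ - (x ^ (n + 1))⁻¹) := by
  rw [iteratedDeriv_succ', Filter.EventuallyEq.iteratedDeriv_eq (g := fun y =>
    (-1) ^ 0 * (Nat.factorial 0 : ℝ) * (((y - 1) ^ (0 + 1))⁻¹ - (y ^ (0 + 1))⁻¹))]
  · refine iteratedDeriv_eqOn_of_hasDerivAt (F := fun n y =>
      (-1) ^ n * (n.factorial : ℝ) * (((y - 1) ^ (n + 1))⁻¹ - (y ^ (n + 1))⁻¹))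
      isOpen_Ioi (fun n y hy => ?_) n hx
    have hy : 1 < y := hy
    have hy0 : y ≠ 0 := by positivity
    have hy1 : y - 1 ≠ 0 := by linarith
    have h1 := ((((hasDerivAt_id y).sub_const 1).fun_pow (n + 1)).fun_inv (pow_ne_zero _ hy1)).fun_sub
      ((hasDerivAt_pow (n + 1) y).fun_inv (pow_ne_zero _ hy0))
    refine (h1.const_mul ((-1) ^ n * (n.factorial : ℝ))).congr_deriv ?_
    simp only [id, Nat.add_sub_cancel, Nat.factorial_succ]
    push_cast
    field_simp
    ring
  · filter_upwards [isOpen_Ioi.mem_nhds (show x ∈ Set.Ioi 1 from hx)] with y hy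
    have hy : 1 < y := hy
    have hy0 : y ≠ 0 := by positivity
    have hy1 : y - 1 ≠ 0 := by linarith
    have h1 := ((((hasDerivAt_id' y).sub_const 1).log hy1).fun_sub
      (Real.hasDerivAt_log hy0)).const_add c
    rw [show deriv _ y = _ from h1.deriv]
    simp

theorem iteratedDeriv_log_ratio (A : ℝ) {k : ℕ} (hk : 0 < k) {x : ℝ} (hx : 1 < x) :
    (-1) ^ k * iteratedDeriv k (fun y : ℝ => (A + Real.log (y - 1)) / Real.log y) x
      = ((A + (Real.log (x - 1) - Real.log x)) * (invLogPoly k).eval (Real.log x)⁻¹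
          - ∑ j ∈ Finset.range k, (k.choose (j + 1) * j.factorial : ℝ)
            * ((x / (x - 1)) ^ (j + 1) - 1)
            * (invLogPoly (k - (j + 1))).eval (Real.log x)⁻¹) / x ^ k := by
  have hx0 : x ≠ 0 := by positivity
  have hx1 : x - 1 ≠ 0 := by linarith
  have hl : Real.log x ≠ 0 := (Real.log_pos hx).ne'
  have hcongr : (fun y : ℝ => (A + Real.log (y - 1)) / Real.log y) =ᶠ[nhds x]
      fun y => 1 + (A + (Real.log (y - 1) - Real.log y)) * (Real.log y)⁻¹ := by
    filter_upwards [isOpen_Ioi.mem_nhds (show x ∈ Set.Ioi 1 from hx)] with y hy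
    have : Real.log y ≠ 0 := (Real.log_pos hy).ne'
    field_simp
    ring
  have hd : ContDiffAt ℝ k (fun y : ℝ => A + (Real.log (y - 1) - Real.log y)) x :=
    contDiffAt_const.add
      (((contDiffAt_id.sub contDiffAt_const).log hx1).sub (contDiffAt_id.log hx0))
  have hd' : ContDiffAt ℝ k (fun y : ℝ => (Real.log y)⁻¹) x := (contDiffAt_id.log hx0).inv hl
  rw [hcongr.iteratedDeriv_eq, iteratedDeriv_const_add hk, iteratedDeriv_fun_mul hd hd',
    Finset.sum_range_succ', mul_add, sub_div, sub_eq_neg_add]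
  congr 1
  · rw [Finset.mul_sum, Finset.sum_div, ← Finset.sum_neg_distrib]
    refine Finset.sum_congr rfl fun j hj => ?_
    obtain ⟨m, rfl⟩ : ∃ m, k = j + 1 + m :=
      Nat.exists_eq_add_of_le (Finset.mem_range.mp hj)
    rw [iteratedDeriv_log_sub_one_sub_log A j hx, iteratedDeriv_inv_log _ hx,
      Nat.add_sub_cancel_left]
    have h1 : ((-1 : ℝ) ^ j) ^ 2 = 1 := by rw [← pow_mul, mul_comm, pow_mul]; simp
    have h2 : ((-1 : ℝ) ^ m) ^ 2 = 1 := by rw [← pow_mul, mul_comm, pow_mul]; simp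
    rw [pow_add x, pow_add (-1 : ℝ), pow_succ (-1 : ℝ), div_pow]
    field_simp
    rw [h1, h2]
    ring
  · rw [iteratedDeriv_zero, Nat.sub_zero, iteratedDeriv_inv_log _ hx, Nat.choose_zero_right]
    have h1 : ((-1 : ℝ) ^ k) ^ 2 = 1 := by rw [← pow_mul, mul_comm, pow_mul]; simp
    field_simp
    rw [h1]
    push_cast
    ring

theorem eval_invLogPoly_nonneg (k : ℕ) {u : ℝ} (hu : 0 ≤ u) : 0 ≤ (invLogPoly k).eval u := by
  have hc : ∀ k n, 0 ≤ (invLogPoly k).coeff n := by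
    intro k
    induction k with
    | zero => intro n; rw [invLogPoly, Polynomial.coeff_X]; positivity
    | succ k ih =>
      intro n
      rw [invLogPoly, Polynomial.coeff_add, Polynomial.coeff_natCast_mul,
        Polynomial.coeff_X_pow_mul', Polynomial.coeff_derivative]
      have := ih n
      have := ih (n - 2 + 1)
      positivity
  rw [Polynomial.eval_eq_sum_range]
  exact Finset.sum_nonneg fun n _ => mul_nonneg (hc k n) (pow_nonneg hu n)

theorem invLogPoly_eval_values (u : ℝ) :
    (invLogPoly 0).eval u = u ∧ (invLogPoly 1).eval u = u ^ 2 ∧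
    (invLogPoly 2).eval u = u ^ 2 + 2 * u ^ 3 ∧
    (invLogPoly 3).eval u = 2 * u ^ 2 + 6 * u ^ 3 + 6 * u ^ 4 ∧
    (invLogPoly 4).eval u = 6 * u ^ 2 + 22 * u ^ 3 + 36 * u ^ 4 + 24 * u ^ 5 ∧
    (invLogPoly 5).eval u = 24 * u ^ 2 + 100 * u ^ 3 + 210 * u ^ 4 + 240 * u ^ 5
      + 120 * u ^ 6 ∧
    (invLogPoly 6).eval u = 120 * u ^ 2 + 548 * u ^ 3 + 1350 * u ^ 4 + 2040 * u ^ 5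
      + 1800 * u ^ 6 + 720 * u ^ 7 := by
  refine ⟨?_, ?_, ?_, ?_, ?_, ?_, ?_⟩ <;> simp [invLogPoly] <;> ring

theorem eval_invLogPoly_lt {k : ℕ} (hk2 : 2 ≤ k) (hk6 : k ≤ 6) {u : ℝ} (hu : 0 < u)
    (hu' : u ≤ 1 / 11.512925) :
    (invLogPoly k).eval u < (if k = 2 then 1.17372 else if k = 3 then 2.56643
      else if k = 4 then 8.19823 else if k = 5 then 34.4344 else (179.227 : ℝ)) * u ^ 2 := by
  obtain ⟨-, -, h2, h3, h4, h5, h6⟩ := invLogPoly_eval_values u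
  have hu2 : 0 < u ^ 2 := by positivity
  have hp (n : ℕ) : u ^ n ≤ (1 / 11.512925) ^ n := pow_le_pow_left₀ hu.le hu' n
  have p2 := hp 2
  have p3 := hp 3
  have p4 := hp 4
  have p5 := hp 5
  norm_num at hu' p2 p3 p4 p5
  interval_cases k
  · have : 1 + 2 * u < 1.17372 := by linarith
    simp only [h2, if_true]
    nlinarith
  · have : 2 + 6 * u + 6 * u ^ 2 < 2.56643 := by linarith
    norm_num [h3] at this ⊢
    nlinarith
  · have : 6 + 22 * u + 36 * u ^ 2 + 24 * u ^ 3 < 8.19823 := by linarith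
    norm_num [h4] at this ⊢
    nlinarith
  · have : 24 + 100 * u + 210 * u ^ 2 + 240 * u ^ 3 + 120 * u ^ 4 < 34.4344 := by linarith
    norm_num [h5] at this ⊢
    nlinarith
  · have : 120 + 548 * u + 1350 * u ^ 2 + 2040 * u ^ 3 + 1800 * u ^ 4 + 720 * u ^ 5
      < 179.227 := by linarith
    norm_num [h6] at this ⊢
    nlinarith

theorem correction_sum_lt {k : ℕ} (hk2 : 2 ≤ k) (hk6 : k ≤ 6) {A u e w : ℝ} (hA : 200000 ≤ A)
    (hu : 0 < u) (hu' : u ≤ 1 / 10) (he : 0 ≤ e) (he1 : e ≤ 1) (heu : e ≤ 5 * u ^ 2)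
    (hw : -e ≤ w) :
    (Nat.factorial (k - 1) : ℝ) * A * u ^ 2 < (A + w) * (invLogPoly k).eval u
      - ∑ j ∈ Finset.range k, (k.choose (j + 1) * j.factorial : ℝ)
            * ((1 + e) ^ (j + 1) - 1) * (invLogPoly (k - (j + 1))).eval u := by
  obtain ⟨h0, h1, h2, h3, h4, h5, h6⟩ := invLogPoly_eval_values u
  have hpow (n : ℕ) : u ^ (n + 1) ≤ (1 / 10) ^ n * u := by
    rw [pow_succ]; gcongr
  have p1 := hpow 1
  have p2 := hpow 2
  have p3 := hpow 3
  have p4 := hpow 4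
  have p5 := hpow 5
  have p6 := hpow 6
  norm_num at p1 p2 p3 p4 p5 p6
  have ht (n : ℕ) : (1 + e) ^ n - 1 ≤ (2 ^ n - 1) * e := by
    induction n with
    | zero => simp
    | succ n ih =>
      have h2n : (1 : ℝ) ≤ 2 ^ n := one_le_pow₀ (by norm_num)
      rw [pow_succ, pow_succ]
      nlinarith [mul_le_mul_of_nonneg_right ih (show 0 ≤ 1 + e by linarith),
        mul_nonneg (mul_nonneg (sub_nonneg.2 h2n) he) (sub_nonneg.2 he1)]
  have hP (m : ℕ) (hm : m ≤ 6) : (invLogPoly m).eval u ≤ 20 * u := by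
    interval_cases m <;> simp only [h0, h1, h2, h3, h4, h5, h6] <;> linarith
  have hterm : ∀ j ∈ Finset.range k, (k.choose (j + 1) * j.factorial : ℝ)
      * ((1 + e) ^ (j + 1) - 1) * (invLogPoly (k - (j + 1))).eval u
      ≤ (k.choose (j + 1) * j.factorial : ℝ) * ((2 ^ (j + 1) - 1) * e) * (20 * u) := by
    intro j _
    have h2n : (1 : ℝ) ≤ 2 ^ (j + 1) := one_le_pow₀ (by norm_num)
    refine mul_le_mul (mul_le_mul_of_nonneg_left (ht _) (by positivity)) (hP _ (by lia))
      (eval_invLogPoly_nonneg _ hu.le) (mul_nonneg (by positivity) (mul_nonneg (by linarith) he))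
  have hS := Finset.sum_le_sum hterm
  have hwP : -(e * (20 * u)) ≤ w * (invLogPoly k).eval u := by
    have hPk := eval_invLogPoly_nonneg k hu.le
    nlinarith [mul_le_mul_of_nonneg_left (hP k hk6) he, mul_le_mul_of_nonneg_right hw hPk]
  have heu3 : e * u ≤ 5 * u ^ 3 := by nlinarith
  have hu3 : 0 < u ^ 3 := by positivity
  have hAu : 200000 * u ^ 3 ≤ A * u ^ 3 := by gcongr
  have q4 : 0 ≤ A * u ^ 4 := by positivity
  have q5 : 0 ≤ A * u ^ 5 := by positivity
  have q6 : 0 ≤ A * u ^ 6 := by positivity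
  have q7 : 0 ≤ A * u ^ 7 := by positivity
  have hK : ∑ j ∈ Finset.range k, (k.choose (j + 1) * j.factorial : ℝ)
      * ((2 ^ (j + 1) - 1) * e) * (20 * u) + e * (20 * u)
      < A * ((invLogPoly k).eval u - (Nat.factorial (k - 1) : ℝ) * u ^ 2) := by
    interval_cases k <;>
    simp only [h2, h3, h4, h5, h6, Finset.sum_range_succ, Finset.sum_range_zero] <;>
    norm_num [Nat.choose, Nat.factorial] <;> linarith
  linarith

theorem stmt9 (N : ℝ) (hN : (10 : ℝ) ^ (100000 : ℕ) ≤ N)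
    (k : ℕ) (hk2 : 2 ≤ k) (hk6 : k ≤ 6) (x : ℝ) (hx : (10 : ℝ) ^ (5 : ℕ) ≤ x) :
    (Nat.factorial (k - 1) : ℝ) * Real.log N / (x ^ k * Real.log x ^ 2)
      < (-1 : ℝ) ^ k
          * iteratedDeriv k (fun y : ℝ => (Real.log N + Real.log (y - 1)) / Real.log y) x ∧
    (-1 : ℝ) ^ k
        * iteratedDeriv k (fun y : ℝ => (Real.log N + Real.log (y - 1)) / Real.log y) x
      < (if k = 2 then 1.17372 else if k = 3 then 2.56643 else if k = 4 then 8.19823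
          else if k = 5 then 34.4344 else (179.227 : ℝ))
          * Real.log N / (x ^ k * Real.log x ^ 2) := by
  have h10 : 2.302585 < Real.log 10 := by
    rw [Real.log_ten_eq]
    linarith [Real.log_two_gt_d9, Real.log_five_gt_d9]
  have hA : 200000 ≤ Real.log N := by
    have := Real.log_le_log (pow_pos (by norm_num) _) hN
    rw [Real.log_pow, Nat.cast_ofNat] at this
    linarith
  have hL : 11.512925 ≤ Real.log x := by
    have := Real.log_le_log (by positivity) hx
    rw [Real.log_pow, Nat.cast_ofNat] at this
    linarith
  have hx5 : 100000 ≤ x := by norm_num at hx; exact hx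
  clear hN hx
  generalize Real.log N = A at hA ⊢
  have hx1 : 1 < x := by linarith
  have hx1' : 0 < x - 1 := by linarith
  have hx0 : 0 < x := by linarith
  rw [iteratedDeriv_log_ratio A (by lia) hx1]
  set u := (Real.log x)⁻¹ with hu_def
  have hL0 : 0 < Real.log x := by linarith
  have hu : 0 < u := inv_pos.2 hL0
  have hu1 : u ≤ 1 / 11.512925 := by
    rw [hu_def, ← one_div]
    exact one_div_le_one_div_of_le (by norm_num) hL
  have he_def : x / (x - 1) = 1 + 1 / (x - 1) := by field_simp; ring
  have hw : Real.log (x - 1) - Real.log x ≤ 0 :=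
    sub_nonpos.2 (Real.log_le_log hx1' (by linarith))
  have hw' : -(1 / (x - 1)) ≤ Real.log (x - 1) - Real.log x := by
    have := Real.log_le_sub_one_of_pos (div_pos hx0 hx1')
    rw [Real.log_div hx0.ne' hx1'.ne', he_def] at this
    linarith
  have he1 : 1 / (x - 1) ≤ 1 := by rw [div_le_one hx1']; linarith
  have heu : 1 / (x - 1) ≤ 5 * u ^ 2 := by
    have hsq : Real.log x ^ 2 ≤ 4 * x := by
      have hs := Real.log_le_self (Real.sqrt_nonneg x)
      rw [Real.log_sqrt hx0.le] at hs
      nlinarith [Real.sq_sqrt hx0.le]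
    rw [hu_def, inv_pow, ← div_eq_mul_inv, div_le_div_iff₀ hx1' (by positivity)]
    linarith
  have hmain (c : ℝ) : c * A / (x ^ k * Real.log x ^ 2) = c * A * u ^ 2 / x ^ k := by
    rw [hu_def]; field_simp
  rw [hmain, hmain, he_def]
  refine ⟨?_, ?_⟩
  · gcongr
    exact correction_sum_lt hk2 hk6 hA hu (hu1.trans (by norm_num)) (by positivity) he1 heu hw'
  · gcongr
    have hS : 0 ≤ ∑ j ∈ Finset.range k, (k.choose (j + 1) * j.factorial : ℝ)
        * ((1 + 1 / (x - 1)) ^ (j + 1) - 1) * (invLogPoly (k - (j + 1))).eval u := by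
      refine Finset.sum_nonneg fun j _ => mul_nonneg (mul_nonneg (by positivity) ?_)
        (eval_invLogPoly_nonneg _ hu.le)
      have : 0 ≤ 1 / (x - 1) := by positivity
      exact sub_nonneg.2 (one_le_pow₀ (by linarith))
    have hP := eval_invLogPoly_lt hk2 hk6 hu hu1
    have hAP := mul_lt_mul_of_pos_left hP (show 0 < A by linarith)
    have := mul_nonpos_of_nonpos_of_nonneg hw (eval_invLogPoly_nonneg k hu.le)
    linarith
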